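/- arXiv:2203.13370 — 4 statements merged into one kernel-verified Lean document; each statement's English description precedes it below -/
import Mathlib

section
/- For every ε > 0 there exists N such that for all n ≥ N the following holds: if 𝓕 is a family of subsets of {1,…,n} that contains no weak Δ-system of size 3 (i.e., no three distinct sets A, B, C ∈ 𝓕 with |A ∩ B| = |B ∩ C| = |C ∩ A|), then |𝓕| ≤ ((2/3)·Θ(C) + ε)^n, where Θ(C) is the capset capacity. -/
/-- A capset in `(ZMod 3)^n`: no three elements, not all equal, summing to zero. -/
def IsCapset {n : ℕ} (S : Finset (Fin n → ZMod 3)) : Prop :=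
  ∀ x ∈ S, ∀ y ∈ S, ∀ z ∈ S, x + y + z = 0 → x = y ∧ y = z

/-- `C_n`, the size of the largest capset in `(ZMod 3)^n`. -/
noncomputable def capsetMax (n : ℕ) : ℕ :=
  sSup {k | ∃ S : Finset (Fin n → ZMod 3), IsCapset S ∧ S.card = k}

/-- The capset capacity `Θ(C) = limsup (C_n)^(1/n)`. -/
noncomputable def capsetCapacity : ℝ :=
  Filter.limsup (fun n : ℕ => (capsetMax n : ℝ) ^ ((1 : ℝ) / n)) Filter.atTop

/-- The support of a vector over `ZMod 3`. -/
def ternarySupport {n : ℕ} (x : Fin n → ZMod 3) : Finset (Fin n) :=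
  Finset.univ.filter fun i => x i ≠ 0

theorem mem_ternarySupport {n : ℕ} {x : Fin n → ZMod 3} {i : Fin n} :
    i ∈ ternarySupport x ↔ x i ≠ 0 := by
  simp [ternarySupport]

theorem card_le_capsetMax {n : ℕ} {S : Finset (Fin n → ZMod 3)} (hS : IsCapset S) :
    S.card ≤ capsetMax n := by
  refine le_csSup ⟨Fintype.card (Fin n → ZMod 3), ?_⟩ ⟨S, hS, rfl⟩
  rintro k ⟨T, -, rfl⟩
  exact Finset.card_le_univ T

theorem capsetMax_le_three_pow (n : ℕ) : capsetMax n ≤ 3 ^ n := by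
  refine csSup_le ⟨0, ∅, by simp [IsCapset], rfl⟩ ?_
  rintro k ⟨T, -, rfl⟩
  simpa using Finset.card_le_univ T

/-- On a line of `(ZMod 3)^n`, the sizes of the pairwise intersections of the shifted supports
are controlled by the sizes of the supports outside the shift. -/
theorem card_inter_symmDiff_add_card_sdiff {n : ℕ} (V : Finset (Fin n))
    {x y z : Fin n → ZMod 3} (h : x + y + z = 0) :
    (symmDiff (ternarySupport x) V ∩ symmDiff (ternarySupport y) V).card
        + (ternarySupport z \ V).card
      = (symmDiff (ternarySupport y) V ∩ symmDiff (ternarySupport z) V).card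
        + (ternarySupport x \ V).card := by
  have key : ∀ a b c : ZMod 3, a + b + c = 0 → ∀ v : Bool,
      (if (xor (decide (a ≠ 0)) v && xor (decide (b ≠ 0)) v) = true then 1 else 0)
        + (if (decide (c ≠ 0) && !v) = true then 1 else 0)
      = (if (xor (decide (b ≠ 0)) v && xor (decide (c ≠ 0)) v) = true then 1 else 0)
        + (if (decide (a ≠ 0) && !v) = true then 1 else 0) := by
    decide
  have hcard : ∀ T : Finset (Fin n), T.card = ∑ i, if i ∈ T then 1 else 0 := by
    intro T
    simp
  rw [hcard, hcard (_ \ _), hcard (_ ∩ _), hcard (ternarySupport x \ V),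
    ← Finset.sum_add_distrib, ← Finset.sum_add_distrib]
  refine Finset.sum_congr rfl fun i _ => ?_
  have hi := key (x i) (y i) (z i) (congrFun h i) (decide (i ∈ V))
  by_cases hv : i ∈ V <;>
    simpa [hv, Finset.mem_inter, Finset.mem_symmDiff, mem_ternarySupport] using hi

/-- On a line of `(ZMod 3)^n` whose points have supports of the same size, equality of two
supports forces the third one to be the same. -/
theorem ternarySupport_eq_of_eq {n : ℕ} {x y z : Fin n → ZMod 3} (h : x + y + z = 0)
    (hxy : ternarySupport x = ternarySupport y)
    (hc : (ternarySupport z).card = (ternarySupport x).card) :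
    ternarySupport z = ternarySupport x := by
  refine Finset.eq_of_subset_of_card_le (fun i hi => ?_) hc.ge
  by_contra hx
  have hy : i ∉ ternarySupport y := hxy ▸ hx
  rw [mem_ternarySupport, not_not] at hx hy
  have hi0 : x i + y i + z i = 0 := congrFun h i
  rw [hx, hy] at hi0
  exact mem_ternarySupport.1 hi (by simpa using hi0)

theorem eq_of_ternarySupport_eq {n : ℕ} {x y z : Fin n → ZMod 3} (h : x + y + z = 0)
    (hxy : ternarySupport x = ternarySupport y) (hxz : ternarySupport z = ternarySupport x) :
    x = y ∧ y = z := by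
  have key : ∀ a b c : ZMod 3, a + b + c = 0 → (a ≠ 0 ↔ b ≠ 0) → (c ≠ 0 ↔ a ≠ 0) →
      a = b ∧ b = c := by
    decide
  have hi : ∀ i, x i = y i ∧ y i = z i := fun i =>
    key _ _ _ (congrFun h i)
      (by simpa only [mem_ternarySupport] using Finset.ext_iff.1 hxy i)
      (by simpa only [mem_ternarySupport] using Finset.ext_iff.1 hxz i)
  exact ⟨funext fun i => (hi i).1, funext fun i => (hi i).2⟩

/-- A family of sets without weak Δ-systems of size 3. -/
def WeakDeltaFree {n : ℕ} (𝓕 : Finset (Finset (Fin n))) : Prop :=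
  ¬ ∃ A ∈ 𝓕, ∃ B ∈ 𝓕, ∃ C ∈ 𝓕, A ≠ B ∧ B ≠ C ∧ A ≠ C ∧
    (A ∩ B).card = (B ∩ C).card ∧ (B ∩ C).card = (C ∩ A).card

theorem WeakDeltaFree.isCapset {n : ℕ} {𝓕 : Finset (Finset (Fin n))} (h𝓕 : WeakDeltaFree 𝓕)
    (V : Finset (Fin n)) (p : ℕ × ℕ) :
    IsCapset {x : Fin n → ZMod 3 | symmDiff (ternarySupport x) V ∈ 𝓕 ∧
      ((ternarySupport x \ V).card, (ternarySupport x).card) = p} := by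
  obtain ⟨k, l⟩ := p
  intro x hx y hy z hz h
  simp only [Finset.mem_filter, Finset.mem_univ, true_and, Prod.mk.injEq] at hx hy hz
  obtain ⟨hx, hxk, hxl⟩ := hx
  obtain ⟨hy, hyk, hyl⟩ := hy
  obtain ⟨hz, hzk, hzl⟩ := hz
  have h' : y + z + x = 0 := by rw [← h]; ring
  have h'' : x + z + y = 0 := by rw [← h]; ring
  have e₁ := card_inter_symmDiff_add_card_sdiff V h
  have e₂ := card_inter_symmDiff_add_card_sdiff V h'
  by_cases hxy : ternarySupport x = ternarySupport y
  · exact eq_of_ternarySupport_eq h hxy (ternarySupport_eq_of_eq h hxy (hzl.trans hxl.symm))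
  by_cases hyz : ternarySupport y = ternarySupport z
  · exact absurd (ternarySupport_eq_of_eq h' hyz (hxl.trans hyl.symm)) hxy
  by_cases hxz : ternarySupport x = ternarySupport z
  · exact absurd (ternarySupport_eq_of_eq h'' hxz (hyl.trans hxl.symm)).symm hxy
  refine absurd ⟨_, hx, _, hy, _, hz, ?_, ?_, ?_, by omega, by omega⟩ h𝓕
  · exact fun e => hxy (symmDiff_left_injective V e)
  · exact fun e => hyz (symmDiff_left_injective V e)
  · exact fun e => hxz (symmDiff_left_injective V e)

theorem WeakDeltaFree.card_preimage_le {n : ℕ} {𝓕 : Finset (Finset (Fin n))}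
    (h𝓕 : WeakDeltaFree 𝓕) (V : Finset (Fin n)) :
    (Finset.univ.filter fun x : Fin n → ZMod 3 => symmDiff (ternarySupport x) V ∈ 𝓕).card
      ≤ (n + 1) ^ 2 * capsetMax n := by
  have hcard : (Finset.range (n + 1) ×ˢ Finset.range (n + 1)).card = (n + 1) ^ 2 := by
    simp [sq]
  rw [mul_comm, ← hcard]
  refine Finset.card_le_mul_card_image_of_maps_to
    (f := fun x => ((ternarySupport x \ V).card, (ternarySupport x).card)) ?_ _ ?_
  · intro x _
    have h₁ := Finset.card_le_univ (ternarySupport x \ V)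
    have h₂ := Finset.card_le_univ (ternarySupport x)
    rw [Fintype.card_fin] at h₁ h₂
    simp only [Finset.mem_product, Finset.mem_range]
    omega
  · intro p _
    rw [Finset.filter_filter]
    exact card_le_capsetMax (h𝓕.isCapset V p)

/-- Double counting: averaging over all shifts `V`. -/
theorem sum_card_preimage_symmDiff {n : ℕ} (𝓕 : Finset (Finset (Fin n))) :
    ∑ V : Finset (Fin n),
      (Finset.univ.filter fun x : Fin n → ZMod 3 => symmDiff (ternarySupport x) V ∈ 𝓕).card
      = 3 ^ n * 𝓕.card := by
  simp only [Finset.card_filter]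
  rw [Finset.sum_comm]
  have hx : ∀ x : Fin n → ZMod 3,
      (∑ V : Finset (Fin n), if symmDiff (ternarySupport x) V ∈ 𝓕 then 1 else 0) = 𝓕.card := by
    intro x
    rw [← Finset.card_filter]
    refine Finset.card_nbij' (fun V => symmDiff (ternarySupport x) V)
      (fun V => symmDiff (ternarySupport x) V) ?_ ?_ ?_ ?_ <;>
      simp +contextual [Set.MapsTo, Set.LeftInvOn]
  simp [hx]

theorem WeakDeltaFree.three_pow_mul_card_le {n : ℕ} {𝓕 : Finset (Finset (Fin n))}
    (h𝓕 : WeakDeltaFree 𝓕) :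
    3 ^ n * 𝓕.card ≤ 2 ^ n * ((n + 1) ^ 2 * capsetMax n) := by
  rw [← sum_card_preimage_symmDiff]
  refine (Finset.sum_le_card_nsmul _ _ _ fun V _ => h𝓕.card_preimage_le V).trans ?_
  simp

theorem capsetMax_rpow_le_three (n : ℕ) : (capsetMax n : ℝ) ^ ((1 : ℝ) / n) ≤ 3 := by
  rcases Nat.eq_zero_or_pos n with rfl | hn
  · simp
  calc (capsetMax n : ℝ) ^ ((1 : ℝ) / n) ≤ ((3 : ℝ) ^ n) ^ ((1 : ℝ) / n) := by
        gcongr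
        exact_mod_cast capsetMax_le_three_pow n
    _ = 3 := by
        rw [one_div, Real.pow_rpow_inv_natCast (by norm_num) hn.ne']

theorem isBoundedUnder_capsetMax_rpow :
    Filter.IsBoundedUnder (· ≤ ·) Filter.atTop
      (fun n : ℕ => (capsetMax n : ℝ) ^ ((1 : ℝ) / n)) :=
  Filter.isBoundedUnder_of ⟨3, capsetMax_rpow_le_three⟩

theorem capsetCapacity_nonneg : 0 ≤ capsetCapacity :=
  Filter.le_limsup_of_frequently_le
    (Filter.Frequently.of_forall fun n => by positivity) isBoundedUnder_capsetMax_rpow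

theorem eventually_capsetMax_le {δ : ℝ} (hδ : 0 < δ) :
    ∀ᶠ n : ℕ in Filter.atTop, (capsetMax n : ℝ) ≤ (capsetCapacity + δ) ^ n := by
  have hlt : capsetCapacity < capsetCapacity + δ := by linarith
  filter_upwards [Filter.eventually_lt_of_limsup_lt hlt isBoundedUnder_capsetMax_rpow,
    Filter.eventually_gt_atTop 0] with n hn hpos
  calc (capsetMax n : ℝ) = ((capsetMax n : ℝ) ^ ((1 : ℝ) / n)) ^ n := by
        rw [one_div, Real.rpow_inv_natCast_pow (by positivity) hpos.ne']
    _ ≤ (capsetCapacity + δ) ^ n := by gcongr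

theorem eventually_sq_mul_pow_le {a b : ℝ} (ha : 0 < a) (hab : a < b) :
    ∀ᶠ n : ℕ in Filter.atTop, ((n : ℝ) + 1) ^ 2 * a ^ n ≤ b ^ n := by
  have hr : 1 < b / a := (one_lt_div ha).2 hab
  have ht := tendsto_pow_const_div_const_pow_of_one_lt 2 hr
  filter_upwards [ht.eventually_lt_const (show (0 : ℝ) < 1 / 4 by norm_num),
    Filter.eventually_ge_atTop 1] with n hn h1
  have h1' : (1 : ℝ) ≤ n := by exact_mod_cast h1
  rw [div_lt_iff₀ (by positivity), div_pow, ← mul_div_assoc, lt_div_iff₀ (by positivity)] at hn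
  have hq : ((n : ℝ) + 1) ^ 2 ≤ 4 * (n : ℝ) ^ 2 := by nlinarith
  nlinarith [mul_le_mul_of_nonneg_right hq (pow_pos ha n).le]

theorem weak_delta_system_free_bound :
    ∀ ε : ℝ, 0 < ε → ∃ N : ℕ, ∀ n : ℕ, N ≤ n →
      ∀ 𝓕 : Finset (Finset (Fin n)),
        (¬ ∃ A ∈ 𝓕, ∃ B ∈ 𝓕, ∃ C ∈ 𝓕, A ≠ B ∧ B ≠ C ∧ A ≠ C ∧
            (A ∩ B).card = (B ∩ C).card ∧ (B ∩ C).card = (C ∩ A).card) →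
        (𝓕.card : ℝ) ≤ ((2 / 3) * capsetCapacity + ε) ^ n := by
  intro ε hε
  have hΘ := capsetCapacity_nonneg
  have ha : 0 < 2 / 3 * (capsetCapacity + ε) := by positivity
  have hab : 2 / 3 * (capsetCapacity + ε) < 2 / 3 * capsetCapacity + ε := by linarith
  obtain ⟨N, hN⟩ := Filter.eventually_atTop.1
    ((eventually_capsetMax_le hε).and (eventually_sq_mul_pow_le ha hab))
  refine ⟨N, fun n hn 𝓕 h𝓕 => ?_⟩
  obtain ⟨hcap, hpoly⟩ := hN n hn
  have hcard : (3 : ℝ) ^ n * 𝓕.card ≤ 2 ^ n * (((n : ℝ) + 1) ^ 2 * capsetMax n) := by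
    exact_mod_cast WeakDeltaFree.three_pow_mul_card_le h𝓕
  calc (𝓕.card : ℝ) ≤ 2 ^ n * (((n : ℝ) + 1) ^ 2 * capsetMax n) / 3 ^ n := by
        rwa [le_div_iff₀ (by positivity), mul_comm]
    _ ≤ 2 ^ n * (((n : ℝ) + 1) ^ 2 * (capsetCapacity + ε) ^ n) / 3 ^ n := by gcongr
    _ = ((n : ℝ) + 1) ^ 2 * (2 / 3 * (capsetCapacity + ε)) ^ n := by
        rw [mul_pow, div_pow]
        ring
    _ ≤ (2 / 3 * capsetCapacity + ε) ^ n := hpoly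
end

section
/- For every ε > 0 there exists N such that for all n ≥ N the following holds: if 𝓕 is a family of subsets of {1,…,n} that contains no weak Δ-system of size 3 (i.e., no three distinct sets A, B, C ∈ 𝓕 with |A ∩ B| = |B ∩ C| = |C ∩ A|), then |𝓕| ≤ ((1/4)·(207 + 33·√33)^{1/3} + ε)^n. (Numerically, (1/4)·(207 + 33·√33)^{1/3} = 1.8367….) -/
open Finset in
/-- A subspace of `X → K` contains a function whose support has at least the dimension of the
subspace many elements. -/
lemma exists_mem_finrank_le_card_support {X K : Type*} [Fintype X] [Field K] [DecidableEq K]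
    (V : Submodule K (X → K)) :
    ∃ h ∈ V, Module.finrank K V ≤ #{x | h x ≠ 0} := by
  classical
  obtain ⟨k, ⟨h, hV, rfl⟩, hk⟩ := Set.Finite.exists_maximal
    (s := {k | ∃ h ∈ V, #{x | h x ≠ 0} = k})
    ((Set.finite_Iic (Fintype.card X)).subset (by rintro _ ⟨h, -, rfl⟩; exact card_le_univ _))
    ⟨_, 0, V.zero_mem, rfl⟩
  refine ⟨h, hV, ?_⟩
  by_contra! hlt
  let res : V →ₗ[K] ({x // h x ≠ 0} → K) :=
    (LinearMap.funLeft K K Subtype.val).comp V.subtype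
  obtain ⟨w, hw, hw0⟩ : ∃ w ∈ LinearMap.ker res, w ≠ 0 := by
    refine Submodule.exists_mem_ne_zero_of_ne_bot (LinearMap.ker_ne_bot_of_finrank_lt ?_)
    rwa [Module.finrank_pi, Fintype.card_subtype]
  have hwh : ∀ x, h x ≠ 0 → (w : X → K) x = 0 := fun x hx =>
    congrFun (LinearMap.mem_ker.mp hw) ⟨x, hx⟩
  obtain ⟨x₀, hx₀⟩ : ∃ x, (w : X → K) x ≠ 0 := by
    by_contra! h0
    exact hw0 (Subtype.ext (funext h0))
  have hssub : ({x | h x ≠ 0} : Finset X) ⊂ ({x | (h + w) x ≠ 0} : Finset X) := by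
    refine (ssubset_iff_of_subset fun x hx => ?_).mpr ⟨x₀, ?_, ?_⟩
    · simp only [mem_filter, mem_univ, true_and] at hx ⊢
      simpa [hwh x hx] using hx
    · have : h x₀ = 0 := by_contra fun hx => hx₀ (hwh x₀ hx)
      simpa [this] using hx₀
    · simpa using fun hx => hx₀ (hwh x₀ hx)
  exact absurd (hk ⟨h + w, V.add_mem hV w.2, rfl⟩ (card_lt_card hssub).le)
    (card_lt_card hssub).not_ge

open Finset in
/-- Slice rank bound: if the diagonal tensor on `X` is a sum of slices, each split off by one of
the functions `f i` in one of the three variables, then `X` has at most three times as many elements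
as there are functions. -/
lemma card_le_of_diagonal_eq_sum_slices {X ι K : Type*} [Fintype X] [Fintype ι] [Field K]
    [DecidableEq X] (f : ι → X → K) (g₁ g₂ g₃ : ι → X → X → K)
    (hT : ∀ x y z, (∑ i, f i x * g₁ i y z) + (∑ i, f i y * g₂ i x z) + (∑ i, f i z * g₃ i x y) =
      if x = y ∧ y = z then 1 else 0) :
    Fintype.card X ≤ 3 * Fintype.card ι := by
  classical
  let L : (X → K) →ₗ[K] (ι → K) := Matrix.mulVecLin (Matrix.of f)
  obtain ⟨h, hV, hcard⟩ := exists_mem_finrank_le_card_support (LinearMap.ker L)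
  have horth : ∀ i, ∑ x, f i x * h x = 0 := fun i => congrFun (LinearMap.mem_ker.mp hV) i
  let P : Matrix X (ι ⊕ ι) K := Matrix.of fun y =>
    Sum.elim (fun i => f i y) (fun i => ∑ x, h x * g₃ i x y)
  let Q : Matrix (ι ⊕ ι) X K := Matrix.of
    (Sum.elim (fun i z => ∑ x, h x * g₂ i x z) (fun i z => f i z))
  have hPQ : Matrix.diagonal h = P * Q := by
    ext y z
    have h1 : ∑ x, h x * ((∑ i, f i x * g₁ i y z) + (∑ i, f i y * g₂ i x z) +
        (∑ i, f i z * g₃ i x y)) = Matrix.diagonal h y z := by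
      simp only [hT, Matrix.diagonal_apply]
      by_cases hyz : y = z <;> simp [hyz]
    have h2 : ∑ x, h x * ∑ i, f i x * g₁ i y z = 0 := by
      simp_rw [mul_sum]
      rw [sum_comm]
      refine sum_eq_zero fun i _ => ?_
      rw [← zero_mul (g₁ i y z), ← horth i, sum_mul]
      exact sum_congr rfl fun x _ => by ring
    rw [← h1, Matrix.mul_apply, Fintype.sum_sum_type]
    simp only [mul_add, sum_add_distrib, h2, zero_add]
    congr 1
    · simp_rw [mul_sum]
      rw [sum_comm]
      refine sum_congr rfl fun i _ => ?_
      simp only [P, Q, Matrix.of_apply, Sum.elim_inl, mul_sum]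
      exact sum_congr rfl fun x _ => by ring
    · simp_rw [mul_sum]
      rw [sum_comm]
      refine sum_congr rfl fun i _ => ?_
      simp only [P, Q, Matrix.of_apply, Sum.elim_inr, sum_mul]
      exact sum_congr rfl fun x _ => by ring
  have hrank : #{x | h x ≠ 0} ≤ 2 * Fintype.card ι := by
    have h1 := (Matrix.rank_mul_le_left P Q).trans (Matrix.rank_le_card_width P)
    rw [← hPQ, Matrix.rank_diagonal, Fintype.card_sum, Fintype.card_subtype] at h1
    omega
  have h1 := L.finrank_range_add_finrank_ker
  have h2 := (LinearMap.range L).finrank_le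
  rw [Module.finrank_pi] at h1 h2
  omega

/-- The exponent vectors in `{0, 1, 2}ⁿ` of total degree at most `2n/3`. -/
def lowDegreeExponents (n : ℕ) : Finset (Fin n → Fin 3) :=
  {α | 3 * ∑ i, (α i : ℕ) ≤ 2 * n}

open Finset in
lemma sum_mul_eq_sum_subtype_mul_sum_fiber {E ι K : Type*} [CommSemiring K] [DecidableEq ι]
    (S : Finset E) (M : Finset ι) (p : E → ι) (hp : ∀ e ∈ S, p e ∈ M) (f : ι → K) (r : E → K) :
    ∑ e ∈ S, f (p e) * r e = ∑ m : M, f m * ∑ e ∈ S with p e = m, r e := by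
  rw [sum_coe_sort M (fun m => f m * ∑ e ∈ S with p e = m, r e),
    ← sum_fiberwise_of_maps_to hp]
  refine sum_congr rfl fun m _ => ?_
  rw [mul_sum]
  exact sum_congr rfl fun e he => by rw [(mem_filter.mp he).2]

/-- The coefficients of `1 - (a + b + c) ^ 2`. -/
def lineCoeff (e : Fin 3 × Fin 3 × Fin 3) : ZMod 3 :=
  if e = (0, 0, 0) then 1 else
  if (e.1 : ℕ) + e.2.1 + e.2.2 = 2 then
    if e.1 = 2 ∨ e.2.1 = 2 ∨ e.2.2 = 2 then -1 else -2
  else 0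

/-- The exponents of the monomials of degree at most two in three variables. -/
def lineExponents : Finset (Fin 3 × Fin 3 × Fin 3) :=
  {e | (e.1 : ℕ) + e.2.1 + e.2.2 ≤ 2}

lemma sum_lineCoeff_mul (a b c : ZMod 3) :
    ∑ e ∈ lineExponents, lineCoeff e * (a ^ (e.1 : ℕ) * b ^ (e.2.1 : ℕ) * c ^ (e.2.2 : ℕ)) =
      if a + b + c = 0 then 1 else 0 := by
  revert a b c
  decide

open Finset in
/-- The Ellenberg–Gijswijt bound for sets without nontrivial lines in `𝔽₃ⁿ`. -/
lemma card_le_three_mul_card_lowDegreeExponents {n : ℕ} (H : Finset (Fin n → ZMod 3))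
    (hH : ∀ x ∈ H, ∀ y ∈ H, ∀ z ∈ H, x + y + z = 0 → x = y ∧ y = z) :
    #H ≤ 3 * #(lowDegreeExponents n) := by
  classical
  let S : Finset (Fin n → Fin 3 × Fin 3 × Fin 3) := Fintype.piFinset fun _ => lineExponents
  let mon : (Fin n → Fin 3) → H → ZMod 3 := fun α x => ∏ i, (x : Fin n → ZMod 3) i ^ (α i : ℕ)
  let co : (Fin n → Fin 3 × Fin 3 × Fin 3) → ZMod 3 := fun e => ∏ i, lineCoeff (e i)
  let p₁ : (Fin n → Fin 3 × Fin 3 × Fin 3) → Fin n → Fin 3 := fun e i => (e i).1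
  let p₂ : (Fin n → Fin 3 × Fin 3 × Fin 3) → Fin n → Fin 3 := fun e i => (e i).2.1
  let p₃ : (Fin n → Fin 3 × Fin 3 × Fin 3) → Fin n → Fin 3 := fun e i => (e i).2.2
  let M := lowDegreeExponents n
  have hdeg : ∀ e ∈ S, p₁ e ∉ M → p₂ e ∉ M → p₃ e ∈ M := by
    intro e he h1 h2
    simp only [M, lowDegreeExponents, mem_filter, mem_univ, true_and] at h1 h2 ⊢
    have h3 : ∑ i, ((p₁ e i : ℕ) + p₂ e i + p₃ e i) ≤ ∑ _i : Fin n, 2 := by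
      refine sum_le_sum fun i _ => ?_
      have := Fintype.mem_piFinset.mp he i
      simpa [lineExponents] using this
    simp only [sum_add_distrib, sum_const, card_univ, Fintype.card_fin, smul_eq_mul] at h3
    omega
  have hT : ∀ x y z : H, ∑ e ∈ S, co e * (mon (p₁ e) x * mon (p₂ e) y * mon (p₃ e) z) =
      if x = y ∧ y = z then 1 else 0 := by
    intro x y z
    simp only [co, mon, p₁, p₂, p₃, ← prod_mul_distrib, S]
    rw [← prod_univ_sum (fun _ => lineExponents) (fun i e => lineCoeff e *
      ((x : Fin n → ZMod 3) i ^ (e.1 : ℕ) * (y : Fin n → ZMod 3) i ^ (e.2.1 : ℕ) *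
        (z : Fin n → ZMod 3) i ^ (e.2.2 : ℕ)))]
    simp only [sum_lineCoeff_mul, prod_ite_zero, prod_const_one]
    refine if_congr ⟨fun h => ?_, ?_⟩ rfl rfl
    · have := hH x x.2 y y.2 z z.2 (funext fun i => h i (mem_univ i))
      exact ⟨Subtype.ext this.1, Subtype.ext this.2⟩
    · rintro ⟨rfl, rfl⟩ i -
      generalize (x : Fin n → ZMod 3) i = a
      revert a
      decide
  have key := card_le_of_diagonal_eq_sum_slices (X := H) (ι := M) (fun m => mon m)
    (fun m y z => ∑ e ∈ (S.filter fun e => p₁ e ∈ M) with p₁ e = m,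
      co e * (mon (p₂ e) y * mon (p₃ e) z))
    (fun m x z => ∑ e ∈ ((S.filter fun e => ¬ p₁ e ∈ M).filter fun e => p₂ e ∈ M) with p₂ e = m,
      co e * (mon (p₁ e) x * mon (p₃ e) z))
    (fun m x y => ∑ e ∈ ((S.filter fun e => ¬ p₁ e ∈ M).filter fun e => ¬ p₂ e ∈ M) with p₃ e = m,
      co e * (mon (p₁ e) x * mon (p₂ e) y)) ?_
  · simpa using key
  · intro x y z
    rw [← hT x y z, ← sum_mul_eq_sum_subtype_mul_sum_fiber _ M p₁ (by simp) (fun m => mon m x),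
      ← sum_mul_eq_sum_subtype_mul_sum_fiber _ M p₂ (by simp) (fun m => mon m y),
      ← sum_mul_eq_sum_subtype_mul_sum_fiber _ M p₃ ?_ (fun m => mon m z),
      ← sum_filter_add_sum_filter_not S (fun e => p₁ e ∈ M),
      ← sum_filter_add_sum_filter_not (S.filter fun e => ¬ p₁ e ∈ M) (fun e => p₂ e ∈ M),
      add_assoc]
    · congr 1
      · exact sum_congr rfl fun e _ => by ring
      · congr 1 <;> exact sum_congr rfl fun e _ => by ring
    · intro e he
      simp only [mem_filter] at he
      exact hdeg e he.1.1 he.1.2 he.2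

open Finset in
lemma card_lowDegreeExponents_mul_pow_le (n : ℕ) {s : ℝ} (hs : 0 ≤ s) (hs1 : s ≤ 1) :
    #(lowDegreeExponents n) * (s ^ 2) ^ n ≤ (1 + s ^ 3 + (s ^ 3) ^ 2) ^ n := by
  have h1 : (1 + s ^ 3 + (s ^ 3) ^ 2) ^ n = ∑ α : Fin n → Fin 3, ∏ i, (s ^ 3) ^ (α i : ℕ) := by
    rw [← Fintype.piFinset_univ,
      ← prod_univ_sum (fun _ => univ) (fun (_ : Fin n) (j : Fin 3) => (s ^ 3) ^ (j : ℕ))]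
    simp [Fin.sum_univ_three]
  rw [h1, ← nsmul_eq_mul]
  refine (card_nsmul_le_sum (lowDegreeExponents n) _ _ fun α hα => ?_).trans
    (sum_le_sum_of_subset_of_nonneg (subset_univ _) fun α _ _ => by positivity)
  rw [prod_pow_eq_pow_sum, ← pow_mul, ← pow_mul]
  exact pow_le_pow_of_le_one hs hs1 (mem_filter.mp hα).2

open Real in
lemma card_lowDegreeExponents_le (n : ℕ) :
    ((lowDegreeExponents n).card : ℝ) ≤
      (3 / 2 * (1 / 4 * (207 + 33 * √33) ^ ((1 : ℝ) / 3))) ^ n := by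
  have h33 : √33 ^ 2 = 33 := sq_sqrt (by norm_num)
  have h1 : 1 < √33 := by rw [lt_sqrt] <;> norm_num
  have h9 : √33 ≤ 9 := by rw [sqrt_le_left] <;> norm_num
  set q := √33
  have ht : 0 < (q - 1) / 8 := by linarith
  obtain ⟨s, hs, hst⟩ : ∃ s : ℝ, 0 < s ∧ s ^ 3 = (q - 1) / 8 := by
    refine ⟨((q - 1) / 8) ^ ((1 : ℝ) / 3), rpow_pos_of_pos ht _, ?_⟩
    rw [← rpow_natCast, ← rpow_mul ht.le]
    norm_num
  obtain ⟨c, hc, hc3⟩ : ∃ c : ℝ, c = (207 + 33 * q) ^ ((1 : ℝ) / 3) ∧ c ^ 3 = 207 + 33 * q := by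
    refine ⟨_, rfl, ?_⟩
    rw [← rpow_natCast, ← rpow_mul (by linarith)]
    norm_num
  have hc0 : 0 ≤ c := hc ▸ rpow_nonneg (by linarith) _
  have hs1 : s ≤ 1 := by
    by_contra! h
    nlinarith [one_lt_pow₀ h (n := 3) (by norm_num)]
  have hid : 1 + s ^ 3 + (s ^ 3) ^ 2 = 3 / 2 * (1 / 4 * c) * s ^ 2 := by
    refine (pow_left_inj₀ (n := 3) (by positivity) (by positivity) (by norm_num)).mp ?_
    have : (3 / 2 * (1 / 4 * c) * s ^ 2) ^ 3 = 27 / 512 * c ^ 3 * (s ^ 3) ^ 2 := by ring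
    rw [this, hc3, hst]
    have h3 : q ^ 3 = 33 * q := by rw [pow_succ, h33]
    have h4 : q ^ 4 = 33 * 33 := by rw [show q ^ 4 = (q ^ 2) ^ 2 by ring, h33]; norm_num
    have h5 : q ^ 5 = 33 * 33 * q := by rw [pow_succ, h4]
    have h6 : q ^ 6 = 33 * 33 * 33 := by rw [show q ^ 6 = (q ^ 2) ^ 3 by ring, h33]; norm_num
    ring_nf
    rw [h6, h5, h4, h3, h33]
    ring
  have hle := card_lowDegreeExponents_mul_pow_le n hs.le hs1
  rw [hid, mul_pow _ (s ^ 2)] at hle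
  rw [← hc]
  exact le_of_mul_le_mul_right hle (by positivity)

open Finset symmDiff in
/-- Inside `s` the nonzero coordinates of `v`, outside `s` the zero ones. -/
def twistedSupport {n : ℕ} (s : Finset (Fin n)) (v : Fin n → ZMod 3) : Finset (Fin n) :=
  s ∆ ({i | v i = 0} : Finset (Fin n))

open Finset in
lemma mem_twistedSupport {n : ℕ} {s : Finset (Fin n)} {v : Fin n → ZMod 3} {i : Fin n} :
    i ∈ twistedSupport s v ↔ (i ∈ s ↔ v i ≠ 0) := by
  simp only [twistedSupport, mem_symmDiff, mem_filter, mem_univ, true_and]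
  tauto

open Finset in
/-- Three sets with traces of equal sizes on `s` and on its complement, such that no point of `s` lies
in exactly one of them and no point outside `s` lies in exactly two of them, form a weak Δ-system;
if the first two of them coincide, all do. -/
lemma card_inter_eq_of_pattern {α : Type*} [DecidableEq α] {s A B C : Finset α}
    (hAB : #(A ∩ s) = #(B ∩ s)) (hBC : #(B ∩ s) = #(C ∩ s))
    (hAC' : #(A \ s) = #(C \ s))
    (hs : ∀ i ∈ s, (i ∈ A ∪ B ↔ i ∈ B ∪ C) ∧ (i ∈ B ∪ C ↔ i ∈ C ∪ A))
    (hs' : ∀ i ∉ s, (i ∈ A ∩ B ↔ i ∈ B ∩ C) ∧ (i ∈ B ∩ C ↔ i ∈ C ∩ A)) :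
    (#(A ∩ B) = #(B ∩ C) ∧ #(B ∩ C) = #(C ∩ A)) ∧ (A = B → A = C) := by
  have split (X : Finset α) : #X = #(X ∩ s) + #(X \ s) := (card_inter_add_card_sdiff X s).symm
  have incl (X Y : Finset α) : #((X ∩ Y) ∩ s) + #((X ∪ Y) ∩ s) = #(X ∩ s) + #(Y ∩ s) := by
    rw [inter_inter_distrib_right, union_inter_distrib_right, card_inter_add_card_union]
  have u1 : (A ∪ B) ∩ s = (B ∪ C) ∩ s := by
    ext i
    simpa only [mem_inter, and_congr_left_iff] using fun hi => (hs i hi).1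
  have u2 : (B ∪ C) ∩ s = (C ∪ A) ∩ s := by
    ext i
    simpa only [mem_inter, and_congr_left_iff] using fun hi => (hs i hi).2
  have i1 : (A ∩ B) \ s = (B ∩ C) \ s := by
    ext i
    simpa only [mem_sdiff, and_congr_left_iff] using fun hi => (hs' i hi).1
  have i2 : (B ∩ C) \ s = (C ∩ A) \ s := by
    ext i
    simpa only [mem_sdiff, and_congr_left_iff] using fun hi => (hs' i hi).2
  refine ⟨?_, fun h => ?_⟩
  · have := incl A B
    have := incl B C
    have := incl C A
    rw [split (A ∩ B), split (B ∩ C), split (C ∩ A), i1, i2]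
    rw [u1, u2] at *
    omega
  · subst h
    have e1 : C ∩ s = A ∩ s := eq_of_subset_of_card_le (by grind) (by omega)
    have e2 : A \ s = C \ s := eq_of_subset_of_card_le (by grind) (by omega)
    rw [← sdiff_union_inter A s, ← sdiff_union_inter C s, e1, e2]

open Finset in
/-- A set family without weak Δ-systems pulls back to line-free sets in `𝔽₃ⁿ`. -/
lemma eq_of_add_eq_zero_of_weakDeltaSystemFree {n : ℕ} {𝓕 : Finset (Finset (Fin n))}
    (h𝓕 : ¬ ∃ A ∈ 𝓕, ∃ B ∈ 𝓕, ∃ C ∈ 𝓕, A ≠ B ∧ B ≠ C ∧ A ≠ C ∧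
      #(A ∩ B) = #(B ∩ C) ∧ #(B ∩ C) = #(C ∩ A))
    {s : Finset (Fin n)} {a b : ℕ} {x y z : Fin n → ZMod 3}
    (hx : twistedSupport s x ∈ 𝓕 ∧ #(twistedSupport s x ∩ s) = a ∧ #(twistedSupport s x \ s) = b)
    (hy : twistedSupport s y ∈ 𝓕 ∧ #(twistedSupport s y ∩ s) = a ∧ #(twistedSupport s y \ s) = b)
    (hz : twistedSupport s z ∈ 𝓕 ∧ #(twistedSupport s z ∩ s) = a ∧ #(twistedSupport s z \ s) = b)
    (h : x + y + z = 0) : x = y ∧ y = z := by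
  have hor : ∀ p q r : ZMod 3, p + q + r = 0 →
      (p ≠ 0 ∨ q ≠ 0 ↔ q ≠ 0 ∨ r ≠ 0) ∧ (q ≠ 0 ∨ r ≠ 0 ↔ r ≠ 0 ∨ p ≠ 0) := by decide
  have hand : ∀ p q r : ZMod 3, p + q + r = 0 →
      (p = 0 ∧ q = 0 ↔ q = 0 ∧ r = 0) ∧ (q = 0 ∧ r = 0 ↔ r = 0 ∧ p = 0) := by decide
  have hsum : ∀ i, x i + y i + z i = 0 := fun i => congrFun h i
  have hs : ∀ i ∈ s,
      (i ∈ twistedSupport s x ∪ twistedSupport s y ↔ i ∈ twistedSupport s y ∪ twistedSupport s z) ∧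
      (i ∈ twistedSupport s y ∪ twistedSupport s z ↔
        i ∈ twistedSupport s z ∪ twistedSupport s x) := by
    intro i hi
    simpa only [mem_union, mem_twistedSupport, hi, true_iff] using hor _ _ _ (hsum i)
  have hs' : ∀ i ∉ s,
      (i ∈ twistedSupport s x ∩ twistedSupport s y ↔ i ∈ twistedSupport s y ∩ twistedSupport s z) ∧
      (i ∈ twistedSupport s y ∩ twistedSupport s z ↔
        i ∈ twistedSupport s z ∩ twistedSupport s x) := by
    intro i hi
    simpa only [mem_inter, mem_twistedSupport, hi, false_iff, not_not] using
      hand _ _ _ (hsum i)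
  have hall : twistedSupport s x = twistedSupport s y ∧ twistedSupport s y = twistedSupport s z := by
    have k1 := card_inter_eq_of_pattern (hx.2.1.trans hy.2.1.symm) (hy.2.1.trans hz.2.1.symm)
      (hx.2.2.trans hz.2.2.symm) hs hs'
    have k2 := card_inter_eq_of_pattern (hy.2.1.trans hz.2.1.symm) (hz.2.1.trans hx.2.1.symm)
      (hy.2.2.trans hx.2.2.symm) (fun i hi => ⟨(hs i hi).2, ((hs i hi).1.trans (hs i hi).2).symm⟩)
      (fun i hi => ⟨(hs' i hi).2, ((hs' i hi).1.trans (hs' i hi).2).symm⟩)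
    have k3 := card_inter_eq_of_pattern (hz.2.1.trans hx.2.1.symm) (hx.2.1.trans hy.2.1.symm)
      (hz.2.2.trans hy.2.2.symm) (fun i hi => ⟨((hs i hi).1.trans (hs i hi).2).symm, (hs i hi).1⟩)
      (fun i hi => ⟨((hs' i hi).1.trans (hs' i hi).2).symm, (hs' i hi).1⟩)
    by_contra hne
    refine h𝓕 ⟨_, hx.1, _, hy.1, _, hz.1, fun e => hne ?_, fun e => hne ?_, fun e => hne ?_, k1.1⟩
    · exact ⟨e, e.symm.trans (k1.2 e)⟩
    · exact ⟨(k2.2 e).symm, e⟩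
    · exact ⟨e.trans (k3.2 e.symm), (k3.2 e.symm).symm⟩
  have hend : ∀ p q r : ZMod 3, p + q + r = 0 → (p ≠ 0 ↔ q ≠ 0) → (q ≠ 0 ↔ r ≠ 0) →
      p = q ∧ q = r := by decide
  have hcoord : ∀ i, x i = y i ∧ y i = z i := by
    intro i
    have e1 := Finset.ext_iff.mp hall.1 i
    have e2 := Finset.ext_iff.mp hall.2 i
    rw [mem_twistedSupport, mem_twistedSupport] at e1 e2
    exact hend _ _ _ (hsum i) (by tauto) (by tauto)
  exact ⟨funext fun i => (hcoord i).1, funext fun i => (hcoord i).2⟩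

open Finset in
lemma three_pow_mul_card_le_of_weakDeltaSystemFree {n : ℕ} {𝓕 : Finset (Finset (Fin n))}
    (h𝓕 : ¬ ∃ A ∈ 𝓕, ∃ B ∈ 𝓕, ∃ C ∈ 𝓕, A ≠ B ∧ B ≠ C ∧ A ≠ C ∧
      #(A ∩ B) = #(B ∩ C) ∧ #(B ∩ C) = #(C ∩ A)) :
    3 ^ n * #𝓕 ≤ 3 * #(lowDegreeExponents n) * (2 ^ n * ((n + 1) * (n + 1))) := by
  classical
  let R : Finset ((Fin n → ZMod 3) × Finset (Fin n)) := {q | twistedSupport q.2 q.1 ∈ 𝓕}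
  have hR : 3 ^ n * #𝓕 ≤ #R := by
    have h1 : #((univ : Finset (Fin n → ZMod 3)) ×ˢ 𝓕) = 3 ^ n * #𝓕 := by
      simp [card_product, ZMod.card]
    rw [← h1]
    refine card_le_card_of_injOn
      (fun q => (q.1, symmDiff q.2 ({i | q.1 i = 0} : Finset (Fin n)))) ?_ ?_
    · rintro ⟨v, A⟩ hq
      refine mem_coe.mpr (mem_filter.mpr ⟨mem_univ _, ?_⟩)
      simpa [twistedSupport] using hq
    · rintro ⟨v, A⟩ - ⟨w, B⟩ - h
      simp only [Prod.mk.injEq] at h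
      obtain ⟨rfl, h⟩ := h
      rw [symmDiff_left_injective _ h]
  have hcard : #((univ : Finset (Finset (Fin n))) ×ˢ (range (n + 1) ×ˢ range (n + 1))) =
      2 ^ n * ((n + 1) * (n + 1)) := by
    simp [card_product]
  rw [← hcard]
  refine hR.trans (card_le_mul_card_image_of_maps_to
    (f := fun q => (q.2, #(twistedSupport q.2 q.1 ∩ q.2), #(twistedSupport q.2 q.1 \ q.2))) ?_ _ ?_)
  · intro q _
    have h (X : Finset (Fin n)) : #X < n + 1 :=
      Nat.lt_succ_of_le (by simpa using card_le_univ X)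
    simp [h]
  · rintro ⟨s, a, b⟩ -
    refine le_trans (card_le_card_of_injOn (t := {v | twistedSupport s v ∈ 𝓕 ∧
      #(twistedSupport s v ∩ s) = a ∧ #(twistedSupport s v \ s) = b}) Prod.fst ?_ ?_)
      (card_le_three_mul_card_lowDegreeExponents _ ?_)
    · rintro ⟨v, t⟩ hq
      simp only [R, coe_filter, Set.mem_ofPred_eq, mem_filter, mem_univ, true_and,
        Prod.mk.injEq] at hq ⊢
      obtain ⟨h, rfl, ha, hb⟩ := hq
      exact ⟨h, ha, hb⟩
    · rintro ⟨v, t⟩ hq ⟨w, t'⟩ hq' h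
      simp only [coe_filter, Set.mem_ofPred_eq, Prod.mk.injEq] at hq hq' h ⊢
      exact ⟨h, hq.2.1.trans hq'.2.1.symm⟩
    · intro x hx y hy z hz h
      simp only [mem_filter, mem_univ, true_and] at hx hy hz
      exact eq_of_add_eq_zero_of_weakDeltaSystemFree h𝓕 hx hy hz h

open Filter Topology in
lemma eventually_poly_mul_pow_le_add_pow {b ε : ℝ} (hb : 0 < b) (hε : 0 < ε) :
    ∀ᶠ n : ℕ in atTop, 3 * ((n : ℝ) + 1) ^ 2 * b ^ n ≤ (b + ε) ^ n := by
  have hlim := tendsto_pow_const_mul_const_pow_of_lt_one 2 (r := b / (b + ε)) (by positivity)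
    ((div_lt_one (by positivity)).mpr (by linarith))
  filter_upwards [hlim.eventually_le_const (show (0 : ℝ) < 1 / 12 by norm_num),
    eventually_ge_atTop 1] with n hn hn1
  have hn1' : (1 : ℝ) ≤ n := by exact_mod_cast hn1
  rw [div_pow, mul_div_assoc', div_le_iff₀ (by positivity)] at hn
  have h1 : 3 * ((n : ℝ) + 1) ^ 2 ≤ 12 * (n : ℝ) ^ 2 := by nlinarith
  have h2 := mul_le_mul_of_nonneg_right h1 (pow_pos hb n).le
  linarith


theorem weak_delta_system_free_numerical_bound :
    ∀ ε : ℝ, 0 < ε → ∃ N : ℕ, ∀ n : ℕ, N ≤ n →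
      ∀ 𝓕 : Finset (Finset (Fin n)),
        (¬ ∃ A ∈ 𝓕, ∃ B ∈ 𝓕, ∃ C ∈ 𝓕, A ≠ B ∧ B ≠ C ∧ A ≠ C ∧
            (A ∩ B).card = (B ∩ C).card ∧ (B ∩ C).card = (C ∩ A).card) →
        (𝓕.card : ℝ) ≤ ((1 / 4) * (207 + 33 * Real.sqrt 33) ^ ((1 : ℝ) / 3) + ε) ^ n := by
  intro ε hε
  set b : ℝ := (1 / 4) * (207 + 33 * Real.sqrt 33) ^ ((1 : ℝ) / 3) with hb
  have hb0 : 0 < b := by positivity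
  obtain ⟨N, hN⟩ := Filter.eventually_atTop.mp (eventually_poly_mul_pow_le_add_pow hb0 hε)
  refine ⟨N, fun n hn 𝓕 h𝓕 => le_trans ?_ (hN n hn)⟩
  have h1 : (3 : ℝ) ^ n * 𝓕.card ≤
      3 * (lowDegreeExponents n).card * (2 ^ n * ((n + 1) * (n + 1))) := by
    exact_mod_cast three_pow_mul_card_le_of_weakDeltaSystemFree h𝓕
  have h2 := card_lowDegreeExponents_le n
  rw [← hb] at h2
  refine le_of_mul_le_mul_left (h1.trans ?_) (show (0 : ℝ) < 3 ^ n by positivity)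
  calc 3 * ((lowDegreeExponents n).card : ℝ) * (2 ^ n * ((n + 1) * (n + 1)))
      ≤ 3 * (3 / 2 * b) ^ n * (2 ^ n * ((n + 1) * (n + 1))) := by gcongr
    _ = 3 ^ n * (3 * ((n : ℝ) + 1) ^ 2 * b ^ n) := by
        rw [mul_pow, div_pow]
        field_simp
end

section
/- Let n ≥ 1 and let A, B ⊆ {0,1}^n with B nonempty. Suppose A contains no equilateral triangle, i.e., no three distinct points of A have all three pairwise Hamming distances equal. Let w_Δ(B) denote the maximum size of a subset of B containing no equilateral triangle. Then |A| · |B| ≤ 2^n · w_Δ(B). -/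
/-- `A` contains an equilateral triangle: three distinct points with all three
pairwise Hamming distances equal. -/
def HasEquilateralTriangle {n : ℕ} (A : Finset (Fin n → Bool)) : Prop :=
  ∃ x ∈ A, ∃ y ∈ A, ∃ z ∈ A, x ≠ y ∧ y ≠ z ∧ x ≠ z ∧
    hammingDist x y = hammingDist y z ∧ hammingDist y z = hammingDist z x

/-- `w_Δ(B)`: the maximum size of a subset of `B` with no equilateral triangle. -/
noncomputable def wDelta {n : ℕ} (B : Finset (Fin n → Bool)) : ℕ :=
  sSup {k | ∃ S ⊆ B, ¬ HasEquilateralTriangle S ∧ S.card = k}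

/-- Translation of the Boolean cube by `t`, i.e. coordinatewise exclusive or. -/
def xorTranslate {n : ℕ} (t x : Fin n → Bool) : Fin n → Bool := fun i => xor (t i) (x i)

theorem xorTranslate_comm {n : ℕ} (t x : Fin n → Bool) :
    xorTranslate t x = xorTranslate x t :=
  funext fun i => Bool.xor_comm (t i) (x i)

theorem xorTranslate_involutive {n : ℕ} (t : Fin n → Bool) :
    Function.Involutive (xorTranslate t) := fun x => by
  funext i
  simp [xorTranslate]

theorem hammingDist_xorTranslate {n : ℕ} (t x y : Fin n → Bool) :
    hammingDist (xorTranslate t x) (xorTranslate t y) = hammingDist x y :=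
  hammingDist_comp (fun i => xor (t i)) fun _ _ _ h => Bool.xor_right_inj.mp h

theorem HasEquilateralTriangle.of_xorTranslate {n : ℕ} {A S : Finset (Fin n → Bool)}
    (t : Fin n → Bool) (hSA : ∀ x ∈ S, xorTranslate t x ∈ A) (hS : HasEquilateralTriangle S) :
    HasEquilateralTriangle A := by
  obtain ⟨x, hx, y, hy, z, hz, hxy, hyz, hxz, h₁, h₂⟩ := hS
  have inj := (xorTranslate_involutive t).injective
  refine ⟨_, hSA x hx, _, hSA y hy, _, hSA z hz, inj.ne hxy, inj.ne hyz, inj.ne hxz, ?_, ?_⟩ <;>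
    simpa only [hammingDist_xorTranslate]

theorem card_le_wDelta {n : ℕ} {S B : Finset (Fin n → Bool)} (hSB : S ⊆ B)
    (hS : ¬ HasEquilateralTriangle S) : S.card ≤ wDelta B := by
  refine le_csSup ⟨B.card, ?_⟩ ⟨S, hSB, hS, rfl⟩
  rintro _ ⟨T, hTB, -, rfl⟩
  exact Finset.card_le_card hTB

theorem card_filter_xorTranslate_mem {n : ℕ} (A : Finset (Fin n → Bool)) (b : Fin n → Bool) :
    (Finset.univ.filter fun t => xorTranslate t b ∈ A).card = A.card := by
  refine Finset.card_bij' (fun t _ => xorTranslate b t) (fun a _ => xorTranslate b a) ?_ ?_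
    (fun t _ => xorTranslate_involutive b t) (fun a _ => xorTranslate_involutive b a)
  · intro t ht
    simpa [xorTranslate_comm b t] using ht
  · intro a ha
    simpa [xorTranslate_comm _ b, xorTranslate_involutive b a] using ha

theorem relative_density_bound {n : ℕ} (hn : 1 ≤ n)
    (A B : Finset (Fin n → Bool)) (hB : B.Nonempty)
    (hA : ¬ HasEquilateralTriangle A) :
    A.card * B.card ≤ 2 ^ n * wDelta B := by
  calc A.card * B.card
      = ∑ b ∈ B, (Finset.univ.filter fun t => xorTranslate t b ∈ A).card := by
        simp [card_filter_xorTranslate_mem, mul_comm]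
    _ = ∑ t : Fin n → Bool, (B.filter fun b => xorTranslate t b ∈ A).card :=
        (Finset.sum_card_bipartiteAbove_eq_sum_card_bipartiteBelow
          fun b t => xorTranslate t b ∈ A)
    _ ≤ ∑ _t : Fin n → Bool, wDelta B := Finset.sum_le_sum fun t _ =>
        card_le_wDelta (Finset.filter_subset _ _) fun h =>
          hA (h.of_xorTranslate t fun _ hx => (Finset.mem_filter.mp hx).2)
    _ = 2 ^ n * wDelta B := by simp
end

section
/- Fix n ≥ 1 and define F : (ℤ/3ℤ)^n → {0,1}^n coordinatewise by F(v)_i = 1 if v_i = 1 and F(v)_i = 0 if v_i ∈ {0, 2}. If A ⊆ {0,1}^n is sunflower-free, then the preimage F⁻¹(A) ⊆ (ℤ/3ℤ)^n is a capset. -/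
/-- The coordinatewise map `F : (ZMod 3)^n → {0,1}^n` sending `1 ↦ 1` and `0, 2 ↦ 0`. -/
def Fmap {n : ℕ} (v : Fin n → ZMod 3) : Fin n → Bool :=
  fun i => decide (v i = 1)

/-- `A ⊆ {0,1}^n` is sunflower-free: it contains no three elements, not all equal,
such that in every coordinate the multiset of values is `{0,0,0}`, `{1,1,1}` or `{0,0,1}`. -/
def SunflowerFree {n : ℕ} (A : Set (Fin n → Bool)) : Prop :=
  ¬ ∃ x ∈ A, ∃ y ∈ A, ∃ z ∈ A, ¬ (x = y ∧ y = z) ∧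
    ∀ i, ({x i, y i, z i} : Multiset Bool) = {false, false, false} ∨
         ({x i, y i, z i} : Multiset Bool) = {true, true, true} ∨
         ({x i, y i, z i} : Multiset Bool) = {false, false, true}

/-- A capset as a set in `(ZMod 3)^n`. -/
def IsCapsetSet {n : ℕ} (S : Set (Fin n → ZMod 3)) : Prop :=
  ∀ x ∈ S, ∀ y ∈ S, ∀ z ∈ S, x + y + z = 0 → x = y ∧ y = z

/-- Three elements of `ZMod 3` summing to zero have images under `a ↦ decide (a = 1)` forming one
of the multisets `{0,0,0}`, `{1,1,1}`, `{0,0,1}`. -/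
theorem decide_eq_one_multiset_of_sum_eq_zero : ∀ a b c : ZMod 3, a + b + c = 0 →
    ({decide (a = 1), decide (b = 1), decide (c = 1)} : Multiset Bool) = {false, false, false} ∨
    ({decide (a = 1), decide (b = 1), decide (c = 1)} : Multiset Bool) = {true, true, true} ∨
    ({decide (a = 1), decide (b = 1), decide (c = 1)} : Multiset Bool) = {false, false, true} := by
  decide

/-- Three elements of `ZMod 3` summing to zero are equal if their images under
`a ↦ decide (a = 1)` are equal. -/
theorem eq_of_sum_eq_zero_of_decide_eq_one_eq : ∀ a b c : ZMod 3, a + b + c = 0 →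
    decide (a = 1) = decide (b = 1) → decide (b = 1) = decide (c = 1) → a = b ∧ b = c := by
  decide

theorem preimage_of_sunflowerFree_isCapset {n : ℕ} (hn : 1 ≤ n)
    (A : Set (Fin n → Bool)) (hA : SunflowerFree A) :
    IsCapsetSet (Fmap ⁻¹' A) := by
  intro x hx y hy z hz hsum
  have hsum_apply (i : Fin n) : x i + y i + z i = 0 := congrFun hsum i
  have himage : Fmap x = Fmap y ∧ Fmap y = Fmap z := by
    by_contra hne
    exact hA ⟨Fmap x, hx, Fmap y, hy, Fmap z, hz, hne, fun i =>
      decide_eq_one_multiset_of_sum_eq_zero _ _ _ (hsum_apply i)⟩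
  have heq (i : Fin n) : x i = y i ∧ y i = z i :=
    eq_of_sum_eq_zero_of_decide_eq_one_eq _ _ _ (hsum_apply i)
      (congrFun himage.1 i) (congrFun himage.2 i)
  exact ⟨funext fun i => (heq i).1, funext fun i => (heq i).2⟩
end
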